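/- arXiv:1612.01361 — 3 statements merged into one kernel-verified Lean document; each statement's English description precedes it below -/
import Mathlib

section
/- Let k = |B|^t − |B|^{t−1}. For every polynomial f ∈ F[x] with deg f ≤ k − 1, every u ∈ F, and every α* ∈ F, the trace repair equation Tr_{F/B}(u·f(α*)) = − Σ_{α ∈ F, α ≠ α*} Tr_{F/B}(u(α − α*)) · Tr_{F/B}(f(α)/(α − α*)) holds, where the products on the right-hand side are taken in B. -/
open Polynomial

/-- The field trace `Tr_{F/B}(x) = ∑_{i=0}^{t-1} x^{q^i}` (with `q = |B|`). -/
noncomputable def fTr (q t : ℕ) {F : Type*} [Field F] (x : F) : F :=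
  ∑ i ∈ Finset.range t, x ^ q ^ i

section TraceMap

variable (B : Type*) {F : Type*} [Field B] [Field F] [Algebra B F] [Fintype B]

theorem frobeniusAlgHom_pow_apply (i : ℕ) (x : F) :
    (FiniteField.frobeniusAlgHom B F ^ i) x = x ^ Fintype.card B ^ i := by
  rw [AlgHom.coe_pow, FiniteField.coe_frobeniusAlgHom, pow_iterate]

theorem fTr_sum (t : ℕ) {ι : Type*} (s : Finset ι) (g : ι → F) :
    fTr (Fintype.card B) t (∑ j ∈ s, g j) = ∑ j ∈ s, fTr (Fintype.card B) t (g j) := by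
  simp only [fTr, ← frobeniusAlgHom_pow_apply B, map_sum]
  exact Finset.sum_comm

theorem fTr_neg (t : ℕ) (x : F) :
    fTr (Fintype.card B) t (-x) = -fTr (Fintype.card B) t x := by
  simp only [fTr, ← frobeniusAlgHom_pow_apply B, map_neg, Finset.sum_neg_distrib]

theorem fTr_mul_of_pow_eq_self {q : ℕ} (t : ℕ) {c : F} (hc : c ^ q = c) (x : F) :
    fTr q t (c * x) = c * fTr q t x := by
  have h (i : ℕ) : c ^ q ^ i = c := by
    have := Function.iterate_fixed (f := (· ^ q)) hc i
    rwa [pow_iterate] at this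
  simp only [fTr, mul_pow, h, Finset.mul_sum]

theorem fTr_pow_card [Fintype F] {t : ℕ} (hF : Fintype.card F = Fintype.card B ^ t) (x : F) :
    fTr (Fintype.card B) t x ^ Fintype.card B = fTr (Fintype.card B) t x := by
  have h : fTr (Fintype.card B) t x ^ Fintype.card B
      = ∑ i ∈ Finset.range t, x ^ Fintype.card B ^ (i + 1) := by
    change FiniteField.frobeniusAlgHom B F _ = _
    simp only [fTr, map_sum, FiniteField.coe_frobeniusAlgHom, ← pow_mul, ← pow_succ]
  have hx : x ^ Fintype.card B ^ t = x := by rw [← hF, FiniteField.pow_card]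
  have h' := (Finset.sum_range_succ (fun i => x ^ Fintype.card B ^ i) t).symm.trans
    (Finset.sum_range_succ' (fun i => x ^ Fintype.card B ^ i) t)
  rw [pow_zero, pow_one, hx] at h'
  rw [h, fTr, add_right_cancel h']

end TraceMap

/-- The polynomial `Tr(u X) / X`. -/
noncomputable def traceQuotient (q t : ℕ) {F : Type*} [Field F] (u : F) : F[X] :=
  ∑ i ∈ Finset.range t, C (u ^ q ^ i) * X ^ (q ^ i - 1)

theorem natDegree_traceQuotient_le {q : ℕ} (hq : 0 < q) (t : ℕ) {F : Type*} [Field F] (u : F) :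
    (traceQuotient q t u).natDegree ≤ q ^ (t - 1) - 1 := by
  refine natDegree_sum_le_of_forall_le _ _ fun i hi => (natDegree_C_mul_X_pow_le _ _).trans ?_
  have := Finset.mem_range.mp hi
  exact Nat.sub_le_sub_right (Nat.pow_le_pow_right hq (by omega)) 1

theorem eval_traceQuotient {q : ℕ} (hq : 0 < q) (t : ℕ) {F : Type*} [Field F] (u : F) {x : F}
    (hx : x ≠ 0) : (traceQuotient q t u).eval x = fTr q t (u * x) / x := by
  rw [eq_div_iff hx, traceQuotient, eval_finsetSum, Finset.sum_mul, fTr]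
  refine Finset.sum_congr rfl fun i _ => ?_
  have := Nat.pow_pos (n := i) hq
  rw [eval_mul, eval_C, eval_pow, eval_X, mul_assoc, ← pow_succ, Nat.sub_add_cancel this, mul_pow]

theorem eval_traceQuotient_zero {q t : ℕ} (hq : 1 < q) (ht : 0 < t) {F : Type*} [Field F]
    (u : F) : (traceQuotient q t u).eval 0 = u := by
  rw [traceQuotient, eval_finsetSum, Finset.sum_eq_single_of_mem 0 (Finset.mem_range.mpr ht)]
  · simp
  · intro i _ hi
    have := Nat.one_lt_pow hi hq
    simp [show q ^ i - 1 ≠ 0 by omega]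

theorem sum_eval_eq_zero_of_natDegree_lt {F : Type*} [Field F] [Fintype F] (g : F[X])
    (hg : g.natDegree < Fintype.card F - 1) : ∑ x : F, g.eval x = 0 := by
  simp only [eval_eq_sum_range]
  rw [Finset.sum_comm]
  refine Finset.sum_eq_zero fun i hi => ?_
  rw [← Finset.mul_sum, FiniteField.sum_pow_lt_card_sub_one, mul_zero]
  have := Finset.mem_range.mp hi
  omega

/-- With `k = |B|^t - |B|^{t-1}`: for every `f ∈ F[x]` with `deg f ≤ k - 1`, every
`u ∈ F` and every `α* ∈ F`, the trace repair equation
`Tr(u·f(α*)) = - ∑_{α ≠ α*} Tr(u(α-α*)) · Tr(f(α)/(α-α*))` holds. -/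
theorem stmt7 (p m t : ℕ) (hp : p.Prime) (hm : 0 < m) (ht : 0 < t)
    (B F : Type*) [Field B] [Field F] [Algebra B F] [Fintype B] [Fintype F] [DecidableEq F]
    (hB : Fintype.card B = p ^ m) (hF : Fintype.card F = Fintype.card B ^ t)
    (k : ℕ) (hk : k = Fintype.card B ^ t - Fintype.card B ^ (t - 1))
    (f : Polynomial F) (hf : f.degree ≤ ((k - 1 : ℕ) : WithBot ℕ)) (u αs : F) :
    fTr (Fintype.card B) t (u * f.eval αs)
      = - ∑ α ∈ Finset.univ.erase αs,
          fTr (Fintype.card B) t (u * (α - αs))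
            * fTr (Fintype.card B) t (f.eval α / (α - αs)) := by
  have hq : 1 < Fintype.card B := Fintype.one_lt_card
  have hq0 : 0 < Fintype.card B := hq.le
  set q := Fintype.card B
  have hlt : q ^ (t - 1) < q ^ t := Nat.pow_lt_pow_right hq (by omega)
  have hpos : 0 < q ^ (t - 1) := Nat.pow_pos hq0
  let h : F[X] := (traceQuotient q t u).comp (X - C αs)
  have hsum : ∑ α : F, (h * f).eval α = 0 := by
    refine sum_eval_eq_zero_of_natDegree_lt _ (natDegree_mul_le.trans_lt ?_)
    have h₁ : h.natDegree ≤ q ^ (t - 1) - 1 := by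
      simpa [h, natDegree_comp] using natDegree_traceQuotient_le hq0 t u
    have h₂ : f.natDegree ≤ k - 1 := natDegree_le_of_degree_le hf
    omega
  have hterm : ∀ α ∈ Finset.univ.erase αs,
      fTr q t (u * (α - αs)) * fTr q t (f.eval α / (α - αs)) = fTr q t ((h * f).eval α) := by
    intro α hα
    have hne : α - αs ≠ 0 := sub_ne_zero.mpr (Finset.ne_of_mem_erase hα)
    rw [← fTr_mul_of_pow_eq_self t (fTr_pow_card B hF _)]
    simp only [h, eval_mul, eval_comp, eval_sub, eval_X, eval_C, eval_traceQuotient hq0 t u hne]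
    congr 1
    ring
  rw [Finset.sum_congr rfl hterm, ← fTr_sum B, ← fTr_neg B]
  congr 1
  rw [← Finset.add_sum_erase _ _ (Finset.mem_univ αs)] at hsum
  rw [← eq_neg_of_add_eq_zero_left hsum]
  simp [h, eval_traceQuotient_zero hq ht]
end

section
/- (Correctness of the centralized two-erasure repair scheme.) Assume the extension degree t is divisible by the characteristic p of F. Let k = |B|^t − |B|^{t−1} and let α*, ᾱ ∈ F be distinct. If f ∈ F[x] is a polynomial with deg f ≤ k − 1 such that Tr_{F/B}(f(α)/(α − α*)) = 0 and Tr_{F/B}(f(α)/(α − ᾱ)) = 0 for every α ∈ F \ {α*, ᾱ}, then f(α*) = 0 and f(ᾱ) = 0. In particular, the pair (f(α*), f(ᾱ)) is determined by the 2(|F| − 2) sub-symbols Tr_{F/B}(f(α)/(α − α*)), Tr_{F/B}(f(α)/(α − ᾱ)) ∈ B, α ∈ F \ {α*, ᾱ}. -/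
open Polynomial

open Finset in
/-- Power sums of low degree vanish, hence so does the sum of the values of a polynomial of degree
less than `|F| - 1`. -/
theorem Polynomial.sum_eval_eq_zero_of_natDegree_lt {F : Type*} [Field F] [Fintype F]
    (f : Polynomial F) (hf : f.natDegree < Fintype.card F - 1) : ∑ x : F, f.eval x = 0 := by
  simp_rw [eval_eq_sum_range]
  rw [sum_comm]
  refine sum_eq_zero fun i hi => ?_
  rw [← mul_sum, FiniteField.sum_pow_lt_card_sub_one, mul_zero]
  have := mem_range.mp hi
  omega

/-- The polynomial `Tr(u (X - a)) / (X - a)`. -/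
noncomputable def repairPoly (q t : ℕ) {F : Type*} [Field F] (a u : F) : Polynomial F :=
  ∑ i ∈ Finset.range t, C (u ^ q ^ i) * (X - C a) ^ (q ^ i - 1)

theorem natDegree_repairPoly_le {q t : ℕ} (hq : 0 < q) {F : Type*} [Field F] (a u : F) :
    (repairPoly q t a u).natDegree ≤ q ^ (t - 1) - 1 := by
  refine natDegree_sum_le_of_forall_le _ _ fun i hi => ?_
  refine (natDegree_C_mul_le _ _).trans ?_
  rw [natDegree_pow, natDegree_X_sub_C, mul_one]
  have := Finset.mem_range.mp hi
  exact Nat.sub_le_sub_right (Nat.pow_le_pow_right hq (by omega)) 1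

theorem eval_repairPoly_self {q t : ℕ} (hq : 1 < q) (ht : 0 < t) {F : Type*} [Field F]
    (a u : F) : (repairPoly q t a u).eval a = u := by
  rw [repairPoly, eval_finsetSum, Finset.sum_eq_single 0]
  · simp
  · intro i _ hi
    have := Nat.one_lt_pow hi hq
    simp [zero_pow (show q ^ i - 1 ≠ 0 by omega)]
  · simp [ht.ne']

theorem eval_repairPoly_of_ne {q t : ℕ} (hq : 0 < q) {F : Type*} [Field F] {a x : F}
    (u : F) (hx : x ≠ a) :
    (repairPoly q t a u).eval x = fTr q t (u * (x - a)) / (x - a) := by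
  have hxa : x - a ≠ 0 := sub_ne_zero.mpr hx
  rw [repairPoly, eval_finsetSum, fTr, Finset.sum_div]
  refine Finset.sum_congr rfl fun i _ => ?_
  rw [eq_div_iff hxa]
  simp only [eval_mul, eval_C, eval_pow, eval_sub, eval_X]
  rw [mul_assoc, ← pow_succ, Nat.sub_add_cancel (Nat.pow_pos hq), mul_pow]

section Trace

variable {B F : Type*} [Field B] [Field F] [Algebra B F] [Fintype B] [Fintype F] {t : ℕ}

theorem finrank_eq_of_card_eq_pow (hF : Fintype.card F = Fintype.card B ^ t) :
    Module.finrank B F = t :=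
  Nat.pow_right_injective (Fintype.one_lt_card (α := B))
    ((Module.card_eq_pow_finrank (K := B) (V := F)).symm.trans hF)

theorem fTr_eq_algebraMap_trace (hF : Fintype.card F = Fintype.card B ^ t) (x : F) :
    fTr (Fintype.card B) t x = algebraMap B F (Algebra.trace B F x) := by
  rw [FiniteField.algebraMap_trace_eq_sum_pow, finrank_eq_of_card_eq_pow hF,
    Nat.card_eq_fintype_card, fTr]

theorem eq_of_forall_trace_mul_eq {x y : F}
    (h : ∀ u : F, Algebra.trace B F (u * x) = Algebra.trace B F (u * y)) : x = y := by
  rw [← sub_eq_zero]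
  refine (traceForm_nondegenerate B F).2 _ fun u => ?_
  rw [Algebra.traceForm_apply, mul_sub, map_sub, h, sub_self]

open Finset Classical in
/-- The repair equation: the traces of the multiples of `f(a)` are expressed through the traces
`Tr(f(x) / (x - a))`, `x ≠ a`. -/
theorem trace_mul_eval_eq (ht : 0 < t) (hF : Fintype.card F = Fintype.card B ^ t)
    {f : Polynomial F}
    (hf : f.natDegree ≤ Fintype.card B ^ t - Fintype.card B ^ (t - 1) - 1) (a u : F) :
    Algebra.trace B F (u * f.eval a) = -∑ x ∈ univ.erase a,
      Algebra.trace B F (u * (x - a)) * Algebra.trace B F (f.eval x / (x - a)) := by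
  have hq : 1 < Fintype.card B := Fintype.one_lt_card
  have hlt : Fintype.card B ^ (t - 1) < Fintype.card B ^ t :=
    Nat.pow_lt_pow_right hq (by omega)
  have hpos : 0 < Fintype.card B ^ (t - 1) := Nat.pow_pos (by omega)
  have hsum := Polynomial.sum_eval_eq_zero_of_natDegree_lt
    (repairPoly (Fintype.card B) t a u * f) (by
      have h1 := natDegree_mul_le (p := repairPoly (Fintype.card B) t a u) (q := f)
      have h2 := natDegree_repairPoly_le (q := Fintype.card B) (t := t) (by omega) a u
      omega)
  rw [← add_sum_erase _ _ (mem_univ a), eval_mul, eval_repairPoly_self hq ht] at hsum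
  rw [eq_neg_of_add_eq_zero_left hsum, map_neg, map_sum]
  refine congrArg _ (sum_congr rfl fun x hx => ?_)
  rw [eval_mul, eval_repairPoly_of_ne (by omega) u (ne_of_mem_erase hx),
    fTr_eq_algebraMap_trace hF, div_mul_eq_mul_div, mul_div_assoc, ← Algebra.smul_def, map_smul,
    smul_eq_mul]

/-- If all traces at the points other than `a` and `b` vanish, then `f(a)` is a `B`-multiple
of `b - a`. -/
theorem eval_eq_of_trace_eq_zero (ht : 0 < t) (hF : Fintype.card F = Fintype.card B ^ t)
    {f : Polynomial F}
    (hf : f.natDegree ≤ Fintype.card B ^ t - Fintype.card B ^ (t - 1) - 1) {a b : F}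
    (hab : a ≠ b)
    (h : ∀ x, x ≠ a → x ≠ b → Algebra.trace B F (f.eval x / (x - a)) = 0) :
    f.eval a = -Algebra.trace B F (f.eval b / (b - a)) • (b - a) := by
  classical
  refine eq_of_forall_trace_mul_eq (B := B) fun u => ?_
  rw [trace_mul_eval_eq ht hF hf, Finset.sum_eq_single b, mul_smul_comm, map_smul, smul_eq_mul]
  · ring
  · intro x hx hxb
    rw [h x (Finset.ne_of_mem_erase hx) hxb, mul_zero]
  · intro hb
    exact absurd (Finset.mem_erase.mpr ⟨hab.symm, Finset.mem_univ b⟩) hb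

/-- If the extension degree vanishes in `B`, the two missing values of `f` are zero. -/
theorem eval_eq_zero_of_trace_eq_zero (ht : 0 < t) (hF : Fintype.card F = Fintype.card B ^ t)
    (ht0 : (t : B) = 0) {f : Polynomial F}
    (hf : f.natDegree ≤ Fintype.card B ^ t - Fintype.card B ^ (t - 1) - 1) {a b : F}
    (hab : a ≠ b)
    (ha : ∀ x, x ≠ a → x ≠ b → Algebra.trace B F (f.eval x / (x - a)) = 0)
    (hb : ∀ x, x ≠ a → x ≠ b → Algebra.trace B F (f.eval x / (x - b)) = 0) :
    f.eval a = 0 ∧ f.eval b = 0 := by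
  have hA := eval_eq_of_trace_eq_zero ht hF hf hab ha
  have hB := eval_eq_of_trace_eq_zero ht hF hf hab.symm fun x h1 h2 => hb x h2 h1
  have hba : b - a ≠ 0 := sub_ne_zero.mpr hab.symm
  have hdiv : f.eval a / (a - b) =
      algebraMap B F (Algebra.trace B F (f.eval b / (b - a))) := by
    rw [hA, div_eq_iff (sub_ne_zero.mpr hab), Algebra.smul_def, map_neg]
    ring
  have hb0 : f.eval b = 0 := by
    rw [hB, hdiv, Algebra.trace_algebraMap, finrank_eq_of_card_eq_pow hF, nsmul_eq_mul, ht0]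
    simp
  refine ⟨?_, hb0⟩
  rw [hA, hb0]
  simp

end Trace

/-- Correctness of the centralized two-erasure repair scheme. Assume `p ∣ t`, let
`k = |B|^t - |B|^{t-1}` and let `α* ≠ ᾱ` in `F`. If `deg f ≤ k - 1` and both
`Tr(f(α)/(α-α*)) = 0` and `Tr(f(α)/(α-ᾱ)) = 0` for every `α ∈ F \ {α*, ᾱ}`, then
`f(α*) = 0` and `f(ᾱ) = 0`. In particular `(f(α*), f(ᾱ))` is determined by the
`2(|F|-2)` sub-symbols `Tr(f(α)/(α-α*)), Tr(f(α)/(α-ᾱ))`, `α ∈ F \ {α*, ᾱ}`. -/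
theorem stmt11 (p m t : ℕ) (hp : p.Prime) (hm : 0 < m) (ht : 0 < t)
    (B F : Type*) [Field B] [Field F] [Algebra B F] [Fintype B] [Fintype F]
    (hB : Fintype.card B = p ^ m) (hF : Fintype.card F = Fintype.card B ^ t)
    [CharP F p] (hpt : p ∣ t)
    (k : ℕ) (hk : k = Fintype.card B ^ t - Fintype.card B ^ (t - 1))
    (αs αb : F) (hne : αs ≠ αb) :
    (∀ f : Polynomial F, f.degree ≤ ((k - 1 : ℕ) : WithBot ℕ) →
      (∀ α : F, α ≠ αs → α ≠ αb →
        fTr (Fintype.card B) t (f.eval α / (α - αs)) = 0 ∧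
        fTr (Fintype.card B) t (f.eval α / (α - αb)) = 0) →
      f.eval αs = 0 ∧ f.eval αb = 0) ∧
    (∀ f g : Polynomial F, f.degree ≤ ((k - 1 : ℕ) : WithBot ℕ) →
      g.degree ≤ ((k - 1 : ℕ) : WithBot ℕ) →
      (∀ α : F, α ≠ αs → α ≠ αb →
        fTr (Fintype.card B) t (f.eval α / (α - αs))
          = fTr (Fintype.card B) t (g.eval α / (α - αs)) ∧
        fTr (Fintype.card B) t (f.eval α / (α - αb))
          = fTr (Fintype.card B) t (g.eval α / (α - αb))) →
      f.eval αs = g.eval αs ∧ f.eval αb = g.eval αb) := by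
  have hzero : ∀ f : Polynomial F, f.degree ≤ ((k - 1 : ℕ) : WithBot ℕ) →
      (∀ α : F, α ≠ αs → α ≠ αb →
        fTr (Fintype.card B) t (f.eval α / (α - αs)) = 0 ∧
        fTr (Fintype.card B) t (f.eval α / (α - αb)) = 0) →
      f.eval αs = 0 ∧ f.eval αb = 0 := by
    intro f hf h
    simp only [fTr_eq_algebraMap_trace hF, map_eq_zero] at h
    have ht0 : (t : B) = 0 := by
      apply (algebraMap B F).injective
      rw [map_natCast, map_zero, CharP.cast_eq_zero_iff F p]
      exact hpt
    exact eval_eq_zero_of_trace_eq_zero ht hF ht0 (hk ▸ natDegree_le_of_degree_le hf) hne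
      (fun x h1 h2 => (h x h1 h2).1) fun x h1 h2 => (h x h1 h2).2
  refine ⟨hzero, fun f g hf hg h => ?_⟩
  have := hzero (f - g) ((degree_sub_le f g).trans (max_le hf hg)) fun x h1 h2 => by
    simpa only [fTr_eq_algebraMap_trace hF, eval_sub, sub_div, map_sub, sub_eq_zero] using h x h1 h2
  simpa only [eval_sub, sub_eq_zero] using this
end

section
/- Let u ∈ F be nonzero and α ∈ F. The set of roots of the polynomial p_{u,α}(x) in F is exactly (α + u^{−1}·K) \ {α}, where K = ker(Tr_{F/B}); this root set has cardinality |B|^{t−1} − 1, and consequently the set {x ∈ F : p_{u,α}(x) ≠ 0} has cardinality |B|^t − |B|^{t−1} + 1. -/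
open Polynomial

/-- The check polynomial `p_{u,α}(x) = ∑_{i=0}^{t-1} u^{q^i} (x - α)^{q^i - 1}`. -/
noncomputable def pPoly (q t : ℕ) {F : Type*} [Field F] (u α : F) : Polynomial F :=
  ∑ i ∈ Finset.range t, Polynomial.C (u ^ q ^ i) * (Polynomial.X - Polynomial.C α) ^ (q ^ i - 1)

theorem eval_pPoly_mul (q t : ℕ) (hq : 0 < q) {F : Type*} [Field F] (u α x : F) :
    (x - α) * (pPoly q t u α).eval x = fTr q t (u * (x - α)) := by
  simp only [pPoly, fTr, eval_finsetSum, Finset.mul_sum]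
  refine Finset.sum_congr rfl fun i _ => ?_
  simp only [eval_mul, eval_C, eval_pow, eval_sub, eval_X]
  rw [mul_left_comm, mul_pow_sub_one (pow_pos hq i).ne', mul_pow]

theorem eval_pPoly_self (q t : ℕ) (hq : 1 < q) (ht : 0 < t) {F : Type*} [Field F] (u α : F) :
    (pPoly q t u α).eval α = u := by
  obtain ⟨s, rfl⟩ := Nat.exists_eq_succ_of_ne_zero ht.ne'
  rw [pPoly, eval_finsetSum, Finset.sum_range_succ']
  simp only [eval_mul, eval_C, eval_pow, eval_sub, eval_X, sub_self, pow_zero, pow_one]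
  rw [Finset.sum_eq_zero, zero_add, Nat.sub_self, pow_zero, mul_one]
  intro i _
  rw [zero_pow (Nat.sub_pos_of_lt (Nat.one_lt_pow i.succ_ne_zero hq)).ne', mul_zero]

theorem setOf_eval_pPoly_eq_zero (q t : ℕ) (hq : 1 < q) (ht : 0 < t) {F : Type*} [Field F]
    (u α : F) (hu : u ≠ 0) :
    {x : F | (pPoly q t u α).eval x = 0} =
      ((fun κ => α + u⁻¹ * κ) '' {z : F | fTr q t z = 0}) \ {α} := by
  ext x
  simp only [Set.mem_ofPred_eq, Set.mem_sdiff, Set.mem_image, Set.mem_singleton_iff]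
  constructor
  · intro hx
    refine ⟨⟨u * (x - α), ?_, by field_simp; ring⟩, ?_⟩
    · rw [← eval_pPoly_mul q t (zero_lt_one.trans hq), hx, mul_zero]
    · rintro rfl
      exact hu (by rw [← hx, eval_pPoly_self q t hq ht])
  · rintro ⟨⟨κ, hκ, rfl⟩, hne⟩
    have h := eval_pPoly_mul q t (zero_lt_one.trans hq) u α (α + u⁻¹ * κ)
    rw [add_sub_cancel_left, mul_inv_cancel_left₀ hu, hκ] at h
    refine (mul_eq_zero.mp h).resolve_left fun h0 => hne ?_
    rw [h0, add_zero]

theorem ncard_setOf_fTr_eq_zero (t : ℕ) (B F : Type*) [Field B] [Field F] [Algebra B F]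
    [Fintype B] [Fintype F] (hF : Fintype.card F = Fintype.card B ^ t) :
    {z : F | fTr (Fintype.card B) t z = 0}.ncard = Fintype.card B ^ (t - 1) := by
  have hrank : Module.finrank B F = t :=
    Nat.pow_right_injective Fintype.one_lt_card
      ((Module.card_eq_pow_finrank (K := B) (V := F)).symm.trans hF)
  have hset : {z : F | fTr (Fintype.card B) t z = 0} = (Algebra.trace B F).ker := by
    ext z
    rw [Set.mem_ofPred_eq, SetLike.mem_coe, LinearMap.mem_ker,
      ← map_eq_zero_iff _ (algebraMap B F).injective, FiniteField.algebraMap_trace_eq_sum_pow,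
      hrank, Nat.card_eq_fintype_card, fTr]
  have hker := LinearMap.finrank_range_add_finrank_ker (Algebra.trace B F)
  rw [LinearMap.range_eq_top.mpr (Algebra.trace_surjective B F), finrank_top,
    Module.finrank_self, hrank] at hker
  rw [hset, ← Nat.card_coe_set_eq, SetLike.coe_sort_coe,
    Module.natCard_eq_pow_finrank (K := B), Nat.card_eq_fintype_card, ← hker,
    Nat.add_sub_cancel_left]

/-- For `u ≠ 0` and `α ∈ F`, the root set of `p_{u,α}` in `F` is exactly
`(α + u⁻¹·K) \ {α}` where `K = ker Tr`; it has cardinality `|B|^{t-1} - 1`, and the set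
of `x` with `p_{u,α}(x) ≠ 0` has cardinality `|B|^t - |B|^{t-1} + 1`. -/
theorem stmt19 (p m t : ℕ) (hp : p.Prime) (hm : 0 < m) (ht : 0 < t)
    (B F : Type*) [Field B] [Field F] [Algebra B F] [Fintype B] [Fintype F]
    (hB : Fintype.card B = p ^ m) (hF : Fintype.card F = Fintype.card B ^ t)
    (u α : F) (hu : u ≠ 0) :
    {x : F | (pPoly (Fintype.card B) t u α).eval x = 0}
        = ((fun κ => α + u⁻¹ * κ) '' {z : F | fTr (Fintype.card B) t z = 0}) \ {α} ∧
      {x : F | (pPoly (Fintype.card B) t u α).eval x = 0}.ncard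
        = Fintype.card B ^ (t - 1) - 1 ∧
      {x : F | (pPoly (Fintype.card B) t u α).eval x ≠ 0}.ncard
        = Fintype.card B ^ t - Fintype.card B ^ (t - 1) + 1 := by
  have hq : 1 < Fintype.card B := Fintype.one_lt_card
  have hroots := setOf_eval_pPoly_eq_zero (Fintype.card B) t hq ht u α hu
  have hcard : {x : F | (pPoly (Fintype.card B) t u α).eval x = 0}.ncard
      = Fintype.card B ^ (t - 1) - 1 := by
    have hinj : Function.Injective fun κ : F => α + u⁻¹ * κ :=
      (add_right_injective α).comp (mul_right_injective₀ (inv_ne_zero hu))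
    rw [hroots, Set.ncard_sdiff_singleton_of_mem, Set.ncard_image_of_injective _ hinj,
      ncard_setOf_fTr_eq_zero t B F hF]
    refine ⟨0, ?_, by simp⟩
    exact Finset.sum_eq_zero fun i _ => zero_pow (pow_pos (zero_lt_one.trans hq) i).ne'
  refine ⟨hroots, hcard, ?_⟩
  have hcompl := Set.ncard_compl {x : F | (pPoly (Fintype.card B) t u α).eval x = 0}
  rw [hcard, Nat.card_eq_fintype_card, hF] at hcompl
  have hpos : 0 < Fintype.card B ^ (t - 1) := pow_pos (zero_lt_one.trans hq) _
  have hle : Fintype.card B ^ (t - 1) ≤ Fintype.card B ^ t :=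
    Nat.pow_le_pow_right (zero_lt_one.trans hq) (Nat.sub_le t 1)
  exact hcompl.trans (by omega)
end
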